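/- An LTLf formula φ is satisfiable iff some accepting state of the transition system T_φ is reachable from the initial state φ, i.e., iff there is a finite sequence of transitions starting at φ and ending in an accepting state. -/

import Mathlib

namespace LTLfPaper

/-- Literals over atomic propositions: `p` or `¬p`. -/
inductive Lit (P : Type) : Type
  | pos (p : P)
  | neg (p : P)

/-- A state is a set of literals; `Σ = 2^L`. -/
abbrev State (P : Type) := Set (Lit P)

/-- LTLf formulas in negation normal form. -/
inductive LTLf (P : Type) : Type
  | tt
  | ff
  | pos (p : P)
  | neg (p : P)
  | and (φ ψ : LTLf P)
  | or (φ ψ : LTLf P)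
  | next (φ : LTLf P)
  | wnext (φ : LTLf P)
  | untl (φ ψ : LTLf P)
  | rel (φ ψ : LTLf P)

/-- Finite-trace (LTLf) satisfaction: traces are (intended nonempty) lists of states;
the suffix `η_i` is `η.drop i`, and the first state `ω0` is `η.getD 0 ∅`. -/
def Sat {P : Type} : LTLf P → List (State P) → Prop
  | .tt, _ => True
  | .ff, _ => False
  | .pos p, η => Lit.pos p ∈ η.getD 0 ∅
  | .neg p, η => Lit.neg p ∈ η.getD 0 ∅
  | .and φ ψ, η => Sat φ η ∧ Sat ψ η
  | .or φ ψ, η => Sat φ η ∨ Sat ψ η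
  | .next φ, η => 1 < η.length ∧ Sat φ η.tail
  | .wnext φ, η => η.length = 1 ∨ (1 < η.length ∧ Sat φ η.tail)
  | .untl φ ψ, η => ∃ i < η.length, Sat ψ (η.drop i) ∧ ∀ j < i, Sat φ (η.drop j)
  | .rel φ ψ, η => (∀ i < η.length, Sat ψ (η.drop i)) ∨
      ∃ i < η.length, Sat φ (η.drop i) ∧ ∀ j ≤ i, Sat ψ (η.drop j)

/-- Infinite-trace (standard LTL) satisfaction, for reading (Xw-free) formulas as LTL.
(The `wnext` clause coincides with `next`; it is irrelevant for Xw-free formulas.) -/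
def SatInf {P : Type} : LTLf P → (ℕ → State P) → Prop
  | .tt, _ => True
  | .ff, _ => False
  | .pos p, ξ => Lit.pos p ∈ ξ 0
  | .neg p, ξ => Lit.neg p ∈ ξ 0
  | .and φ ψ, ξ => SatInf φ ξ ∧ SatInf ψ ξ
  | .or φ ψ, ξ => SatInf φ ξ ∨ SatInf ψ ξ
  | .next φ, ξ => SatInf φ (fun n => ξ (n + 1))
  | .wnext φ, ξ => SatInf φ (fun n => ξ (n + 1))
  | .untl φ ψ, ξ => ∃ i, SatInf ψ (fun n => ξ (n + i)) ∧ ∀ j < i, SatInf φ (fun n => ξ (n + j))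
  | .rel φ ψ, ξ => (∀ i, SatInf ψ (fun n => ξ (n + i))) ∨
      ∃ i, SatInf φ (fun n => ξ (n + i)) ∧ ∀ j ≤ i, SatInf ψ (fun n => ξ (n + j))

/-- A formula is Xw-free iff it contains no `Xw` operator. -/
def XwFree {P : Type} : LTLf P → Prop
  | .wnext _ => False
  | .and φ ψ | .or φ ψ | .untl φ ψ | .rel φ ψ => XwFree φ ∧ XwFree ψ
  | .next φ => XwFree φ
  | _ => True

/-- Propositional satisfaction `ω ⊨ α` (only meaningful for propositional formulas). -/
def PSat {P : Type} (ω : State P) : LTLf P → Prop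
  | .tt => True
  | .ff => False
  | .pos p => Lit.pos p ∈ ω
  | .neg p => Lit.neg p ∈ ω
  | .and α β => PSat ω α ∧ PSat ω β
  | .or α β => PSat ω α ∨ PSat ω β
  | _ => False

/-- `DF φ`: the set of disjuncts of `φ`. -/
def DF {P : Type} : LTLf P → Set (LTLf P)
  | .or φ ψ => DF φ ∪ DF ψ
  | φ => {φ}

/-- `CF φ`: the set of conjuncts of `φ`. -/
def CF {P : Type} : LTLf P → Set (LTLf P)
  | .and φ ψ => CF φ ∪ CF ψ
  | φ => {φ}

/-- `CF(α)` viewed as a single state: the set of literals occurring as conjuncts of `α`. -/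
def litsOf {P : Type} : LTLf P → State P
  | .and α β => litsOf α ∪ litsOf β
  | .pos p => {Lit.pos p}
  | .neg p => {Lit.neg p}
  | _ => ∅

/-- `NFmem φ α ψ` means the clause `α ∧ X(ψ)` belongs to the normal form `NF(φ)`. -/
inductive NFmem {P : Type} : LTLf P → LTLf P → LTLf P → Prop
  | tt : NFmem .tt .tt .tt
  | pos (p : P) : NFmem (.pos p) (.pos p) .tt
  | neg (p : P) : NFmem (.neg p) (.neg p) .tt
  | next {φ ψ : LTLf P} : ψ ∈ DF φ → NFmem (.next φ) .tt ψ
  | wnext {φ ψ : LTLf P} : ψ ∈ DF φ → NFmem (.wnext φ) .tt ψ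
  | untl₁ {φ₁ φ₂ α ψ : LTLf P} : NFmem φ₂ α ψ → NFmem (.untl φ₁ φ₂) α ψ
  | untl₂ {φ₁ φ₂ α ψ : LTLf P} :
      NFmem (.and φ₁ (.next (.untl φ₁ φ₂))) α ψ → NFmem (.untl φ₁ φ₂) α ψ
  | rel₁ {φ₁ φ₂ α ψ : LTLf P} : NFmem (.and φ₁ φ₂) α ψ → NFmem (.rel φ₁ φ₂) α ψ
  | rel₂ {φ₁ φ₂ α ψ : LTLf P} :
      NFmem (.and φ₂ (.next (.rel φ₁ φ₂))) α ψ → NFmem (.rel φ₁ φ₂) α ψ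
  | or₁ {φ₁ φ₂ α ψ : LTLf P} : NFmem φ₁ α ψ → NFmem (.or φ₁ φ₂) α ψ
  | or₂ {φ₁ φ₂ α ψ : LTLf P} : NFmem φ₂ α ψ → NFmem (.or φ₁ φ₂) α ψ
  | and' {φ₁ φ₂ α₁ ψ₁ α₂ ψ₂ : LTLf P} : NFmem φ₁ α₁ ψ₁ → NFmem φ₂ α₂ ψ₂ →
      NFmem (.and φ₁ φ₂) (.and α₁ α₂) (.and ψ₁ ψ₂)

/-- One transition step of the transition system `T_φ`. -/
def Step {P : Type} (ψ₁ ψ₂ : LTLf P) : Prop := ∃ α, NFmem ψ₁ α ψ₂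

/-- Reachability in the transition system by a finite sequence of transitions. -/
def Reachable {P : Type} (φ ψ : LTLf P) : Prop := Relation.ReflTransGen Step φ ψ

/-- A state `ψ₁` is accepting iff some transition `ψ₁ →α ψ₂` satisfies `CF(α) ⊨ ψ₁`. -/
def Accepting {P : Type} (ψ₁ : LTLf P) : Prop :=
  ∃ α ψ₂, NFmem ψ₁ α ψ₂ ∧ Sat ψ₁ [litsOf α]

/-- The release obligation formula `ofr`. -/
def ofr {P : Type} : LTLf P → LTLf P
  | .tt => .tt
  | .ff => .ff
  | .pos p => .pos p
  | .neg p => .neg p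
  | .and φ ψ => .and (ofr φ) (ofr ψ)
  | .or φ ψ => .or (ofr φ) (ofr ψ)
  | .next _ => .ff
  | .wnext _ => .ff
  | .untl _ ψ => ofr ψ
  | .rel _ ψ => ofr ψ

/-- The global obligation formula `ofg`. -/
def ofg {P : Type} : LTLf P → LTLf P
  | .tt => .tt
  | .ff => .ff
  | .pos p => .pos p
  | .neg p => .neg p
  | .and φ ψ => .and (ofg φ) (ofg ψ)
  | .or φ ψ => .or (ofg φ) (ofg ψ)
  | .next _ => .ff
  | .wnext _ => .tt
  | .untl _ ψ => ofg ψ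
  | .rel _ ψ => ofg ψ

/-- The general obligation formula `off`. -/
def off {P : Type} : LTLf P → LTLf P
  | .tt => .tt
  | .ff => .ff
  | .pos p => .pos p
  | .neg p => .neg p
  | .and φ ψ => .and (off φ) (off ψ)
  | .or φ ψ => .or (off φ) (off ψ)
  | .next φ => off φ
  | .wnext φ => off φ
  | .untl _ ψ => off ψ
  | .rel _ ψ => ofr ψ


theorem DF_nonempty {P : Type} (φ : LTLf P) : (DF φ).Nonempty := by
  induction φ with
  | or φ ψ ih₁ _ => exact ih₁.mono Set.subset_union_left
  | _ => exact Set.singleton_nonempty _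

theorem sat_iff_exists_mem_DF {P : Type} (φ : LTLf P) (η : List (State P)) :
    Sat φ η ↔ ∃ ψ ∈ DF φ, Sat ψ η := by
  induction φ with
  | or φ ψ ih₁ ih₂ => simp only [Sat, DF, Set.mem_union, ih₁, ih₂, or_and_right, exists_or]
  | _ => simp [DF]

theorem sat_untl_cons {P : Type} {φ ψ : LTLf P} {ω : State P} {η : List (State P)} :
    Sat (.untl φ ψ) (ω :: η) ↔
      Sat ψ (ω :: η) ∨ (Sat φ (ω :: η) ∧ Sat (.untl φ ψ) η) := by
  simp only [Sat]
  constructor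
  · rintro ⟨_ | i, hi, hψ, hφ⟩
    · exact .inl hψ
    · exact .inr ⟨hφ 0 i.succ_pos, i, Nat.lt_of_succ_lt_succ hi, hψ,
        fun j hj => hφ (j + 1) (Nat.succ_lt_succ hj)⟩
  · rintro (h | ⟨h, i, hi, hψ, hφ⟩)
    · exact ⟨0, by simp, h, by simp⟩
    · refine ⟨i + 1, Nat.succ_lt_succ hi, hψ, ?_⟩
      rintro (_ | j) hj
      · exact h
      · exact hφ j (Nat.lt_of_succ_lt_succ hj)

theorem sat_rel_cons {P : Type} {φ ψ : LTLf P} {ω : State P} {η : List (State P)} :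
    Sat (.rel φ ψ) (ω :: η) ↔
      Sat ψ (ω :: η) ∧ (Sat φ (ω :: η) ∨ Sat (.rel φ ψ) η) := by
  simp only [Sat]
  constructor
  · rintro (h | ⟨_ | i, hi, hφ, hψ⟩)
    · exact ⟨h 0 (by simp), .inr (.inl fun i hi => h (i + 1) (Nat.succ_lt_succ hi))⟩
    · exact ⟨hψ 0 le_rfl, .inl hφ⟩
    · exact ⟨hψ 0 (Nat.zero_le _), .inr (.inr ⟨i, Nat.lt_of_succ_lt_succ hi, hφ,
        fun j hj => hψ (j + 1) (Nat.succ_le_succ hj)⟩)⟩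
  · rintro ⟨h, h' | h' | ⟨i, hi, hφ, hψ⟩⟩
    · refine .inr ⟨0, by simp, h', fun j hj => ?_⟩
      obtain rfl := Nat.le_zero.mp hj
      exact h
    · left
      rintro (_ | i) hi
      · exact h
      · exact h' i (Nat.lt_of_succ_lt_succ hi)
    · refine .inr ⟨i + 1, Nat.succ_lt_succ hi, hφ, ?_⟩
      rintro (_ | j) hj
      · exact h
      · exact hψ j (Nat.le_of_succ_le_succ hj)

theorem sat_next_cons {P : Type} {φ : LTLf P} {ω : State P} {η : List (State P)} :
    Sat (.next φ) (ω :: η) ↔ η ≠ [] ∧ Sat φ η := by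
  simp [Sat, List.length_pos_iff]

theorem sat_wnext_cons {P : Type} {φ : LTLf P} {ω : State P} {η : List (State P)} :
    Sat (.wnext φ) (ω :: η) ↔ η = [] ∨ (η ≠ [] ∧ Sat φ η) := by
  simp [Sat, List.length_pos_iff]

/-- A clause of the normal form whose literals hold now and whose next part holds on a nonempty
remainder implies the formula. -/
theorem NFmem.sat_cons {P : Type} {φ α ψ : LTLf P} (h : NFmem φ α ψ) {ω : State P}
    {η : List (State P)} (hα : litsOf α ⊆ ω) (hη : η ≠ []) (hψ : Sat ψ η) :
    Sat φ (ω :: η) := by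
  induction h with
  | tt => trivial
  | pos p => exact hα rfl
  | neg p => exact hα rfl
  | next hd => exact sat_next_cons.2 ⟨hη, (sat_iff_exists_mem_DF _ _).2 ⟨_, hd, hψ⟩⟩
  | wnext hd => exact sat_wnext_cons.2 (.inr ⟨hη, (sat_iff_exists_mem_DF _ _).2 ⟨_, hd, hψ⟩⟩)
  | untl₁ _ ih => exact sat_untl_cons.2 (.inl (ih hα hψ))
  | untl₂ _ ih =>
    obtain ⟨h₁, h₂⟩ := ih hα hψ
    exact sat_untl_cons.2 (.inr ⟨h₁, (sat_next_cons.1 h₂).2⟩)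
  | rel₁ _ ih =>
    obtain ⟨h₁, h₂⟩ := ih hα hψ
    exact sat_rel_cons.2 ⟨h₂, .inl h₁⟩
  | rel₂ _ ih =>
    obtain ⟨h₁, h₂⟩ := ih hα hψ
    exact sat_rel_cons.2 ⟨h₁, .inr (sat_next_cons.1 h₂).2⟩
  | or₁ _ ih => exact .inl (ih hα hψ)
  | or₂ _ ih => exact .inr (ih hα hψ)
  | and' _ _ ih₁ ih₂ =>
    obtain ⟨hα₁, hα₂⟩ := Set.union_subset_iff.1 hα
    exact ⟨ih₁ hα₁ hψ.1, ih₂ hα₂ hψ.2⟩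

theorem exists_NFmem_next {P : Type} (φ : LTLf P) : ∃ ψ, NFmem (.next φ) .tt ψ :=
  (DF_nonempty φ).imp fun _ => .next

/-- A formula true on a one-state trace has a clause whose literals alone force it there. -/
theorem exists_NFmem_of_sat_singleton {P : Type} {φ : LTLf P} {ω : State P}
    (h : Sat φ [ω]) :
    ∃ α ψ, NFmem φ α ψ ∧ ∀ ω' : State P, litsOf α ⊆ ω' → Sat φ [ω'] := by
  induction φ with
  | tt => exact ⟨_, _, .tt, fun _ _ => trivial⟩
  | ff => exact h.elim
  | pos p => exact ⟨_, _, .pos p, fun _ hω => hω rfl⟩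
  | neg p => exact ⟨_, _, .neg p, fun _ hω => hω rfl⟩
  | and φ₁ φ₂ ih₁ ih₂ =>
    obtain ⟨α₁, ψ₁, hn₁, hs₁⟩ := ih₁ h.1
    obtain ⟨α₂, ψ₂, hn₂, hs₂⟩ := ih₂ h.2
    exact ⟨_, _, .and' hn₁ hn₂, fun ω' hω =>
      have hω := Set.union_subset_iff.1 hω
      ⟨hs₁ ω' hω.1, hs₂ ω' hω.2⟩⟩
  | or φ₁ φ₂ ih₁ ih₂ =>
    rcases h with h | h
    · obtain ⟨α, ψ, hn, hs⟩ := ih₁ h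
      exact ⟨α, ψ, .or₁ hn, fun ω' hω => .inl (hs ω' hω)⟩
    · obtain ⟨α, ψ, hn, hs⟩ := ih₂ h
      exact ⟨α, ψ, .or₂ hn, fun ω' hω => .inr (hs ω' hω)⟩
  | next φ _ => exact absurd rfl (sat_next_cons.1 h).1
  | wnext φ _ =>
    obtain ⟨ψ, hψ⟩ := DF_nonempty φ
    exact ⟨_, ψ, .wnext hψ, fun _ _ => .inl rfl⟩
  | untl φ₁ φ₂ _ ih₂ =>
    have h₂ : Sat φ₂ [ω] := (sat_untl_cons.1 h).resolve_right fun h' => by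
      simp [Sat] at h'
    obtain ⟨α, ψ, hn, hs⟩ := ih₂ h₂
    exact ⟨α, ψ, .untl₁ hn, fun ω' hω => sat_untl_cons.2 (.inl (hs ω' hω))⟩
  | rel φ₁ φ₂ _ ih₂ =>
    obtain ⟨α, ψ, hn, hs⟩ := ih₂ (sat_rel_cons.1 h).1
    obtain ⟨χ, hχ⟩ := exists_NFmem_next (.rel φ₁ φ₂)
    exact ⟨_, _, .rel₂ (.and' hn hχ), fun ω' hω =>
      sat_rel_cons.2 ⟨hs ω' (Set.union_subset_iff.1 hω).1, .inr (.inl (by simp))⟩⟩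

/-- A formula true on a trace with a nonempty tail has a clause whose next part holds on the
tail. -/
theorem exists_NFmem_of_sat_cons {P : Type} {φ : LTLf P} {ω : State P} {η : List (State P)}
    (hη : η ≠ []) (h : Sat φ (ω :: η)) : ∃ α ψ, NFmem φ α ψ ∧ Sat ψ η := by
  have next {φ : LTLf P} (h : Sat φ η) : ∃ ψ, NFmem (.next φ) .tt ψ ∧ Sat ψ η := by
    obtain ⟨ψ, hd, hψ⟩ := (sat_iff_exists_mem_DF φ η).1 h
    exact ⟨ψ, .next hd, hψ⟩
  induction φ with
  | tt => exact ⟨_, _, .tt, trivial⟩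
  | ff => exact h.elim
  | pos p => exact ⟨_, _, .pos p, trivial⟩
  | neg p => exact ⟨_, _, .neg p, trivial⟩
  | and φ₁ φ₂ ih₁ ih₂ =>
    obtain ⟨α₁, ψ₁, hn₁, hs₁⟩ := ih₁ h.1
    obtain ⟨α₂, ψ₂, hn₂, hs₂⟩ := ih₂ h.2
    exact ⟨_, _, .and' hn₁ hn₂, hs₁, hs₂⟩
  | or φ₁ φ₂ ih₁ ih₂ =>
    rcases h with h | h
    · obtain ⟨α, ψ, hn, hs⟩ := ih₁ h
      exact ⟨α, ψ, .or₁ hn, hs⟩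
    · obtain ⟨α, ψ, hn, hs⟩ := ih₂ h
      exact ⟨α, ψ, .or₂ hn, hs⟩
  | next φ _ => exact ⟨_, next (sat_next_cons.1 h).2⟩
  | wnext φ _ =>
    obtain ⟨ψ, hd, hψ⟩ := (sat_iff_exists_mem_DF φ η).1 ((sat_wnext_cons.1 h).resolve_left hη).2
    exact ⟨_, ψ, .wnext hd, hψ⟩
  | untl φ₁ φ₂ ih₁ ih₂ =>
    rcases sat_untl_cons.1 h with h₂ | ⟨h₁, hU⟩
    · obtain ⟨α, ψ, hn, hs⟩ := ih₂ h₂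
      exact ⟨α, ψ, .untl₁ hn, hs⟩
    · obtain ⟨α, ψ, hn, hs⟩ := ih₁ h₁
      obtain ⟨χ, hχ, hsχ⟩ := next hU
      exact ⟨_, _, .untl₂ (.and' hn hχ), hs, hsχ⟩
  | rel φ₁ φ₂ ih₁ ih₂ =>
    obtain ⟨h₂, h'⟩ := sat_rel_cons.1 h
    obtain ⟨α₂, ψ₂, hn₂, hs₂⟩ := ih₂ h₂
    rcases h' with h₁ | hR
    · obtain ⟨α₁, ψ₁, hn₁, hs₁⟩ := ih₁ h₁
      exact ⟨_, _, .rel₁ (.and' hn₁ hn₂), hs₁, hs₂⟩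
    · obtain ⟨χ, hχ, hsχ⟩ := next hR
      exact ⟨_, _, .rel₂ (.and' hn₂ hχ), hs₂, hsχ⟩

theorem exists_reachable_accepting_of_sat {P : Type} {φ : LTLf P} {ω : State P}
    {η : List (State P)} (h : Sat φ (ω :: η)) : ∃ ψ, Reachable φ ψ ∧ Accepting ψ := by
  induction η generalizing φ ω with
  | nil =>
    obtain ⟨α, ψ, hn, hs⟩ := exists_NFmem_of_sat_singleton h
    exact ⟨φ, .refl, α, ψ, hn, hs _ subset_rfl⟩
  | cons ω' η ih =>
    obtain ⟨α, ψ, hn, hs⟩ := exists_NFmem_of_sat_cons (List.cons_ne_nil _ _) h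
    obtain ⟨χ, hr, ha⟩ := ih hs
    exact ⟨χ, hr.head ⟨α, hn⟩, ha⟩

/-- `φ` is satisfiable iff some accepting state of `T_φ` is reachable
from the initial state `φ` by a finite sequence of transitions. -/
theorem stmt5 {P : Type} (φ : LTLf P) :
    (∃ η : List (State P), η ≠ [] ∧ Sat φ η) ↔
    ∃ ψ, Reachable φ ψ ∧ Accepting ψ := by
  constructor
  · rintro ⟨_ | ⟨ω, η⟩, hη, h⟩
    · exact absurd rfl hη
    · exact exists_reachable_accepting_of_sat h
  · rintro ⟨ψ, hr, α, χ, -, hs⟩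
    induction hr using Relation.ReflTransGen.head_induction_on with
    | refl => exact ⟨_, List.cons_ne_nil _ _, hs⟩
    | head hstep _ ih =>
      obtain ⟨β, hn⟩ := hstep
      obtain ⟨η, hη, hsat⟩ := ih
      exact ⟨litsOf β :: η, List.cons_ne_nil _ _, hn.sat_cons subset_rfl hη hsat⟩

end LTLfPaper
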